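/- For every n ≥ 2, the commutator subgroup of the braid group B_n intersects the center of B_n trivially: commutator B_n ⊓ Subgroup.center B_n = ⊥ (as subgroups of B_n). -/

import Mathlib

/-- The braid relations on `n` strands, as elements of the free group on `Fin (n-1)`. -/
def braidRels (n : ℕ) : Set (FreeGroup (Fin (n - 1))) :=
  {r | ∃ i j : Fin (n - 1), 2 ≤ |(i : ℤ) - (j : ℤ)| ∧
      r = FreeGroup.of i * FreeGroup.of j * (FreeGroup.of j * FreeGroup.of i)⁻¹} ∪
  {r | ∃ i j : Fin (n - 1), |(i : ℤ) - (j : ℤ)| = 1 ∧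
      r = FreeGroup.of i * FreeGroup.of j * FreeGroup.of i *
        (FreeGroup.of j * FreeGroup.of i * FreeGroup.of j)⁻¹}

/-- The braid group on `n` strands. -/
abbrev B (n : ℕ) : Type := PresentedGroup (braidRels n)

/-- The standard generators of the braid group. -/
def σ {n : ℕ} (i : Fin (n - 1)) : B n := PresentedGroup.of i

/-- The defining relations of the Artin monoid of small type attached to a graph: adjacent
generators braid and distinct non-adjacent generators commute. -/
inductive ArtinMonoid.Relation {I : Type*} (Γ : SimpleGraph I) : FreeMonoid I → FreeMonoid I → Prop
  | comm {a b : I} (hab : a ≠ b) (h : ¬ Γ.Adj a b) :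
      Relation Γ (.of a * .of b) (.of b * .of a)
  | braid {a b : I} (h : Γ.Adj a b) :
      Relation Γ (.of a * .of b * .of a) (.of b * .of a * .of b)

/-- The Artin monoid of small type attached to a graph. -/
abbrev ArtinMonoid {I : Type*} (Γ : SimpleGraph I) : Type _ :=
  PresentedMonoid (ArtinMonoid.Relation Γ)

namespace ArtinMonoid

variable {I : Type*} {Γ : SimpleGraph I}

/-- The generators of the Artin monoid. -/
def gen (Γ : SimpleGraph I) (a : I) : ArtinMonoid Γ := PresentedMonoid.of _ a

theorem gen_comm {a b : I} (h : ¬ Γ.Adj a b) : gen Γ a * gen Γ b = gen Γ b * gen Γ a := by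
  by_cases hab : a = b
  · rw [hab]
  · exact PresentedMonoid.mk_eq_mk_of_rel (.comm hab h)

theorem gen_braid {a b : I} (h : Γ.Adj a b) :
    gen Γ a * gen Γ b * gen Γ a = gen Γ b * gen Γ a * gen Γ b :=
  PresentedMonoid.mk_eq_mk_of_rel (.braid h)

theorem gen_comm_assoc {a b : I} (h : ¬ Γ.Adj a b) (x : ArtinMonoid Γ) :
    gen Γ a * (gen Γ b * x) = gen Γ b * (gen Γ a * x) := by
  rw [← mul_assoc, gen_comm h, mul_assoc]

theorem gen_braid_assoc {a b : I} (h : Γ.Adj a b) (x : ArtinMonoid Γ) :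
    gen Γ a * (gen Γ b * (gen Γ a * x)) = gen Γ b * (gen Γ a * (gen Γ b * x)) := by
  have := congrArg (· * x) (gen_braid h)
  simpa only [mul_assoc] using this

/-- The length homomorphism, sending every generator to `1`. -/
def lengthHom (Γ : SimpleGraph I) : ArtinMonoid Γ →* Multiplicative ℕ :=
  PresentedMonoid.lift (fun _ => Multiplicative.ofAdd 1) (by
    rintro _ _ (⟨_, _⟩ | ⟨_⟩) <;> simp)

/-- The word length of an element of the Artin monoid. -/
def length (x : ArtinMonoid Γ) : ℕ := (lengthHom Γ x).toAdd

@[simp] theorem length_one : length (1 : ArtinMonoid Γ) = 0 := by simp [length]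

@[simp] theorem length_mul (x y : ArtinMonoid Γ) : length (x * y) = length x + length y := by
  simp [length]

@[simp] theorem length_gen (a : I) : length (gen Γ a) = 1 := rfl

theorem eq_one_or_eq_gen_mul (x : ArtinMonoid Γ) : x = 1 ∨ ∃ a y, x = gen Γ a * y := by
  obtain ⟨w, rfl⟩ := PresentedMonoid.surjective_mk x
  cases w with
  | one => exact Or.inl rfl
  | of_mul a w => exact Or.inr ⟨a, PresentedMonoid.mk _ w, map_mul _ _ _⟩

theorem eq_one_of_length_eq_zero {x : ArtinMonoid Γ} (h : length x = 0) : x = 1 := by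
  obtain rfl | ⟨a, y, rfl⟩ := eq_one_or_eq_gen_mul x
  · rfl
  · simp at h

/-- `Residual a b u v` says that `gen a * u = gen b * v` is a right multiple of the least
common right multiple of `gen a` and `gen b`, in the obvious way. -/
inductive Residual (Γ : SimpleGraph I) : I → I → ArtinMonoid Γ → ArtinMonoid Γ → Prop
  | refl (a : I) (u : ArtinMonoid Γ) : Residual Γ a a u u
  | comm {a b : I} (hab : a ≠ b) (h : ¬ Γ.Adj a b) (w : ArtinMonoid Γ) :
      Residual Γ a b (gen Γ b * w) (gen Γ a * w)
  | braid {a b : I} (h : Γ.Adj a b) (w : ArtinMonoid Γ) :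
      Residual Γ a b (gen Γ b * (gen Γ a * w)) (gen Γ a * (gen Γ b * w))

namespace Residual

variable {a b c : I} {u v w x : ArtinMonoid Γ}

theorem symm (h : Residual Γ a b u v) : Residual Γ b a v u := by
  cases h with
  | refl => exact .refl _ _
  | comm hab h w => exact .comm hab.symm (fun h' => h h'.symm) w
  | braid h w => exact .braid h.symm w

theorem mul_right (h : Residual Γ a b u v) (x : ArtinMonoid Γ) :
    Residual Γ a b (u * x) (v * x) := by
  cases h with
  | refl => exact .refl _ _
  | comm hab h w => simpa only [mul_assoc] using Residual.comm hab h (w * x)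
  | braid h w => simpa only [mul_assoc] using Residual.braid h (w * x)

theorem eq_of_self (h : Residual Γ a a u v) : u = v := by
  cases h with
  | refl => rfl
  | comm hab => exact absurd rfl hab
  | braid h => exact absurd h Γ.irrefl

theorem exists_of_not_adj (h : Residual Γ a b u v) (hab : a ≠ b) (h' : ¬ Γ.Adj a b) :
    ∃ w, u = gen Γ b * w ∧ v = gen Γ a * w := by
  cases h with
  | refl => exact absurd rfl hab
  | comm _ _ w => exact ⟨w, rfl, rfl⟩
  | braid h => exact absurd h h'

theorem exists_of_adj (h : Residual Γ a b u v) (h' : Γ.Adj a b) :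
    ∃ w, u = gen Γ b * (gen Γ a * w) ∧ v = gen Γ a * (gen Γ b * w) := by
  cases h with
  | refl => exact absurd h' Γ.irrefl
  | comm _ h => exact absurd h' h
  | braid _ w => exact ⟨w, rfl, rfl⟩

/-- A right multiple of both `gen a` and `gen c` which is also a right multiple of `gen b`,
where `b` and `c` commute. -/
theorem trans_comm {N : ℕ}
    (ih : ∀ (a b : I) (u v : ArtinMonoid Γ), length u < N → gen Γ a * u = gen Γ b * v →
      Residual Γ a b u v) (hw : length w = N) (hab : a ≠ b) (hcb : c ≠ b) (hcb' : ¬ Γ.Adj c b)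
    {q : ArtinMonoid Γ} (hq : w = gen Γ b * q)
    (h₁ : Residual Γ a c u w) : Residual Γ a b u (gen Γ c * q) := by
  have hbc := gen_comm_assoc hcb'
  cases h₁ with
  | refl =>
    obtain rfl := hq
    exact .comm hcb hcb' _
  | comm hac hac' p =>
    have hac := gen_comm_assoc hac'
    simp only [length_mul, length_gen] at hw
    by_cases h : Γ.Adj a b
    · obtain ⟨r, rfl, rfl⟩ := (ih _ _ _ _ (by omega) hq).exists_of_adj h
      rw [hbc, ← hac, ← hac, hbc]
      exact .braid h _
    · obtain ⟨r, rfl, rfl⟩ := (ih _ _ _ _ (by omega) hq).exists_of_not_adj hab h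
      rw [hbc, ← hac]
      exact .comm hab h _
  | braid hac' p =>
    have hac := gen_braid_assoc hac'
    simp only [length_mul, length_gen] at hw
    have hL := congrArg length hq
    simp only [length_mul, length_gen] at hL
    by_cases h : Γ.Adj a b
    · obtain ⟨r, hr, rfl⟩ :=
        (ih _ _ _ _ (by simp only [length_mul, length_gen]; omega) hq).exists_of_adj h
      obtain ⟨s, rfl, hs⟩ := (ih _ _ _ _ (by omega) hr).exists_of_not_adj hcb hcb'
      simp only [length_mul, length_gen] at hL hw
      obtain ⟨t, rfl, rfl⟩ := (ih _ _ _ _ (by omega) hs).exists_of_adj hac'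
      have hab := gen_braid_assoc h
      rw [hab, hbc, ← hbc t, ← hac, ← hbc (gen Γ a * t), ← hac, hab, hbc]
      exact .braid h _
    · obtain ⟨r, hr, rfl⟩ :=
        (ih _ _ _ _ (by simp only [length_mul, length_gen]; omega) hq).exists_of_not_adj hab h
      obtain ⟨s, rfl, rfl⟩ := (ih _ _ _ _ (by omega) hr).exists_of_not_adj hcb hcb'
      have hab' := gen_comm_assoc h
      rw [hab', hbc, ← hac]
      exact .comm hab h _

/-- Transitivity of `Residual`, given that the word `w` in the middle is long enough for common
multiples of generators to be understood in smaller length. -/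
theorem trans (hΓ : ∀ a b c, Γ.Adj a b → Γ.Adj b c → ¬ Γ.Adj a c)
    (ih : ∀ (a b : I) (u v : ArtinMonoid Γ), length u < length w → gen Γ a * u = gen Γ b * v →
      Residual Γ a b u v)
    (h₁ : Residual Γ a c u w) (h₂ : Residual Γ c b w v) : Residual Γ a b u v := by
  obtain ⟨w', hw⟩ : ∃ w', w = w' := ⟨w, rfl⟩
  rw [hw] at h₂
  by_cases hab : a = b
  · subst hab
    have h₂ := h₂.symm
    cases h₁ with
    | refl => exact (hw ▸ h₂.eq_of_self) ▸ .refl _ _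
    | comm hac hac' p =>
      obtain ⟨q, rfl, rfl⟩ := h₂.exists_of_not_adj hac hac'
      rw [(ih a a p q (by simp) hw).eq_of_self]
      exact .refl _ _
    | braid hac p =>
      obtain ⟨q, rfl, rfl⟩ := h₂.exists_of_adj hac
      have := (ih _ _ _ _ (by simp) hw).eq_of_self
      rw [(ih c c p q (by simp; omega) this).eq_of_self]
      exact .refl _ _
  cases h₂ with
  | refl => exact hw ▸ h₁
  | comm hcb hcb' q => exact trans_comm ih rfl hab hcb hcb' hw h₁
  | braid hcb q =>
    cases h₁ with
    | refl => exact hw ▸ .braid hcb _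
    | comm hac hac' p =>
      refine (trans_comm ih rfl (Ne.symm hab) hac.symm (fun h => hac' h.symm) rfl ?_).symm
      exact hw ▸ (Residual.braid hcb q).symm
    | braid hac p =>
      have hab' := hΓ _ _ _ hac hcb
      obtain ⟨r, hr, hr'⟩ := (ih _ _ _ _ (by simp) hw).exists_of_not_adj hab hab'
      have hL := congrArg length hw
      have hL' := congrArg length hr'
      simp only [length_mul, length_gen] at hL hL'
      obtain ⟨s, rfl, rfl⟩ :=
        (ih _ _ _ _ (by simp only [length_mul, length_gen]; omega) hr).exists_of_adj hcb
      simp only [length_mul, length_gen] at hL hL'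
      obtain ⟨t, rfl, ht⟩ :=
        (ih _ _ _ _ (by simp only [length_mul, length_gen]; omega) hr').exists_of_adj hac.symm
      have ht := (ih _ _ _ _ (by simp only [length_mul, length_gen] at *; omega) ht).eq_of_self
      obtain ⟨m, rfl, rfl⟩ := (ih _ _ _ _ (by simp only [length_mul, length_gen] at *; omega)
        ht).exists_of_not_adj (Ne.symm hab) (fun h => hab' h.symm)
      have eab := gen_comm_assoc hab'
      have eac := gen_braid_assoc hac
      have ecb := gen_braid_assoc hcb
      rw [eab, eac, ecb, ← eab (gen Γ c * (gen Γ b * m)), ← ecb m,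
        ← eac (gen Γ b * (gen Γ c * m)), eab (gen Γ c * m)]
      exact .comm hab hab' _

end Residual

theorem length_eq_of_conGen {x y : FreeMonoid I} (h : ConGen.Rel (Relation Γ) x y) :
    x.length = y.length := by
  induction h with
  | of _ _ h => cases h <;> simp
  | refl => rfl
  | symm _ ih => exact ih.symm
  | trans _ _ ih₁ ih₂ => exact ih₁.trans ih₂
  | mul _ _ ih₁ ih₂ => simp [ih₁, ih₂]

theorem length_mk (x : FreeMonoid I) :
    length (PresentedMonoid.mk (Relation Γ) x) = x.length := by
  induction x with
  | one => rfl
  | of => rfl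
  | mul x y hx hy => simp [hx, hy]

theorem residual_of_conGen (hΓ : ∀ a b c, Γ.Adj a b → Γ.Adj b c → ¬ Γ.Adj a c) {N : ℕ}
    (ih : ∀ (a b : I) (u v : ArtinMonoid Γ), length u < N → gen Γ a * u = gen Γ b * v →
      Residual Γ a b u v) {x y : FreeMonoid I} (h : ConGen.Rel (Relation Γ) x y)
    (hx : x.length ≤ N + 1) :
    (x = 1 ∧ y = 1) ∨ ∃ a b u v, x = .of a * u ∧ y = .of b * v ∧
      Residual Γ a b (PresentedMonoid.mk _ u) (PresentedMonoid.mk _ v) := by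
  induction h with
  | of _ _ h =>
    right
    cases h with
    | @comm a b hab h =>
      have := Residual.comm hab h 1
      rw [mul_one, mul_one] at this
      exact ⟨a, b, _, _, rfl, rfl, this⟩
    | @braid a b h =>
      have := Residual.braid h 1
      rw [mul_one, mul_one] at this
      exact ⟨a, b, _, _, mul_assoc _ _ _, mul_assoc _ _ _, this⟩
  | refl x =>
    cases x with
    | one => exact Or.inl ⟨rfl, rfl⟩
    | of_mul a x => exact Or.inr ⟨a, a, x, x, rfl, rfl, .refl _ _⟩
  | symm h ih' =>
    obtain ⟨h₁, h₂⟩ | ⟨a, b, u, v, hu, hv, h⟩ := ih' (length_eq_of_conGen h ▸ hx)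
    · exact Or.inl ⟨h₂, h₁⟩
    · exact Or.inr ⟨b, a, v, u, hv, hu, h.symm⟩
  | trans h₁ h₂ ih₁ ih₂ =>
    have hy := length_eq_of_conGen h₁
    obtain ⟨hx', rfl⟩ | ⟨a, c, u, w, hu, hw, hR⟩ := ih₁ hx
    · obtain ⟨-, h₂⟩ | ⟨a, b, u, v, hu, hv, h⟩ := ih₂ (hy ▸ hx)
      · exact Or.inl ⟨hx', h₂⟩
      · exact absurd (congrArg FreeMonoid.length hu) (by simp; omega)
    · obtain ⟨rfl, -⟩ | ⟨c', b, w', v, hw', hv, hR'⟩ := ih₂ (hy ▸ hx)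
      · exact absurd (congrArg FreeMonoid.length hw) (by simp; omega)
      · obtain ⟨rfl, rfl⟩ : c = c' ∧ w = w' := List.cons.inj (hw.symm.trans hw')
        refine Or.inr ⟨a, b, u, v, hu, hv, hR.trans hΓ (fun _ _ _ _ hlt => ih _ _ _ _ ?_) hR'⟩
        rw [length_mk] at hlt
        have := congrArg FreeMonoid.length hw
        simp only [FreeMonoid.length_mul, FreeMonoid.length_of] at this
        omega
  | mul h₁ h₂ ih₁ ih₂ =>
    rw [FreeMonoid.length_mul] at hx
    obtain ⟨rfl, rfl⟩ | ⟨a, b, u, v, rfl, rfl, hR⟩ := ih₁ (by omega)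
    · simpa using ih₂ (by omega)
    · refine Or.inr ⟨a, b, _, _, mul_assoc _ _ _, mul_assoc _ _ _, ?_⟩
      rw [map_mul, map_mul, ← PresentedMonoid.mk_eq_mk_iff.2 h₂]
      exact hR.mul_right _

/-- Garside's lemma: a common right multiple of two generators of an Artin monoid is a right
multiple of their least common multiple. -/
theorem residual_of_gen_mul_eq (hΓ : ∀ a b c, Γ.Adj a b → Γ.Adj b c → ¬ Γ.Adj a c)
    {a b : I} {u v : ArtinMonoid Γ} (h : gen Γ a * u = gen Γ b * v) : Residual Γ a b u v := by
  induction hN : length u using Nat.strong_induction_on generalizing a b u v with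
  | _ N ih =>
    obtain ⟨u, rfl⟩ := PresentedMonoid.surjective_mk u
    obtain ⟨v, rfl⟩ := PresentedMonoid.surjective_mk v
    have h' : PresentedMonoid.mk (Relation Γ) (.of a * u) = PresentedMonoid.mk _ (.of b * v) := h
    rw [length_mk] at hN
    obtain ⟨h, -⟩ | ⟨a', b', u', v', hu, hv, hR⟩ := residual_of_conGen hΓ
      (fun a b u v hlt h => ih _ hlt h rfl) (PresentedMonoid.mk_eq_mk_iff.1 h') (by simp; omega)
    · simpa using congrArg FreeMonoid.length h
    · obtain ⟨rfl, rfl⟩ : a = a' ∧ u = u' := List.cons.inj hu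
      obtain ⟨rfl, rfl⟩ : b = b' ∧ v = v' := List.cons.inj hv
      exact hR

theorem isLeftCancelMul (hΓ : ∀ a b c, Γ.Adj a b → Γ.Adj b c → ¬ Γ.Adj a c) :
    IsLeftCancelMul (ArtinMonoid Γ) where
  mul_left_cancel x := by
    intro y z h
    induction hN : length x generalizing x with
    | zero =>
      obtain rfl := eq_one_of_length_eq_zero hN
      simpa using h
    | succ N ih =>
      obtain rfl | ⟨a, x, rfl⟩ := eq_one_or_eq_gen_mul x
      · simpa using h
      · simp only [mul_assoc] at h
        exact ih x (residual_of_gen_mul_eq hΓ h).eq_of_self (by simp at hN; omega)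

theorem length_le_of_dvd {x y : ArtinMonoid Γ} (h : x ∣ y) : length x ≤ length y := by
  obtain ⟨z, rfl⟩ := h
  simp

/-- `IsMaxCommonDvd P Q D` says that `D` is a common left divisor of `P` and `Q` of maximal
length. -/
structure IsMaxCommonDvd (P Q D : ArtinMonoid Γ) : Prop where
  dvd_left : D ∣ P
  dvd_right : D ∣ Q
  length_le : ∀ E, E ∣ P → E ∣ Q → length E ≤ length D

theorem exists_isMaxCommonDvd (P Q : ArtinMonoid Γ) : ∃ D, IsMaxCommonDvd P Q D := by
  let S : Set ℕ := {n | ∃ E, E ∣ P ∧ E ∣ Q ∧ length E = n}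
  have hS : BddAbove S := ⟨length P, by rintro _ ⟨E, hE, -, rfl⟩; exact length_le_of_dvd hE⟩
  obtain ⟨D, hP, hQ, hD⟩ : sSup S ∈ S :=
    Nat.sSup_mem ⟨0, 1, ⟨P, (one_mul _).symm⟩, ⟨Q, (one_mul _).symm⟩, length_one⟩ hS
  exact ⟨D, hP, hQ, fun E hEP hEQ => hD ▸ le_csSup hS ⟨E, hEP, hEQ, rfl⟩⟩

section LeftCancel

variable [IsLeftCancelMul (ArtinMonoid Γ)]
  (hΓ : ∀ a b c, Γ.Adj a b → Γ.Adj b c → ¬ Γ.Adj a c)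
include hΓ

theorem mul_gen_mul_gen_dvd_of_not_adj {x P : ArtinMonoid Γ} {a b : I} (hab : a ≠ b)
    (h : ¬ Γ.Adj a b) (ha : x * gen Γ a ∣ P) (hb : x * gen Γ b ∣ P) :
    x * gen Γ b * gen Γ a ∣ P := by
  obtain ⟨u, rfl⟩ := ha
  obtain ⟨v, hv⟩ := hb
  rw [mul_assoc, mul_assoc] at hv
  obtain ⟨w, rfl, rfl⟩ :=
    (residual_of_gen_mul_eq hΓ (mul_left_cancel hv)).exists_of_not_adj hab h
  exact ⟨w, by simp only [mul_assoc, gen_comm_assoc h]⟩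

theorem mul_gen_mul_gen_mul_gen_dvd_of_adj {x P : ArtinMonoid Γ} {a b : I}
    (h : Γ.Adj a b) (ha : x * gen Γ a ∣ P) (hb : x * gen Γ b ∣ P) :
    x * gen Γ b * gen Γ a * gen Γ b ∣ P := by
  obtain ⟨u, rfl⟩ := ha
  obtain ⟨v, hv⟩ := hb
  rw [mul_assoc, mul_assoc] at hv
  obtain ⟨w, rfl, rfl⟩ :=
    (residual_of_gen_mul_eq hΓ (mul_left_cancel hv)).exists_of_adj h
  exact ⟨w, by simp only [mul_assoc, gen_braid_assoc h]⟩

namespace IsMaxCommonDvd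

variable {P Q D : ArtinMonoid Γ}

theorem mul_gen_dvd (hD : IsMaxCommonDvd P Q D) {x z : ArtinMonoid Γ} {a : I} (hz : D = x * z)
    (hP : x * gen Γ a ∣ P) (hQ : x * gen Γ a ∣ Q) : x * gen Γ a ∣ D := by
  induction hN : length z using Nat.strong_induction_on generalizing x z a with
  | _ N ih =>
    obtain rfl | ⟨b, z, rfl⟩ := eq_one_or_eq_gen_mul z
    · have := hD.length_le _ hP hQ
      simp [hz] at this
    have hb : x * gen Γ b ∣ D := ⟨z, by rw [hz, mul_assoc]⟩
    rw [length_mul, length_gen] at hN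
    by_cases hab : a = b
    · rwa [hab]
    by_cases h : Γ.Adj a b
    · have hP' := mul_gen_mul_gen_mul_gen_dvd_of_adj hΓ h hP (hb.trans hD.dvd_left)
      have hQ' := mul_gen_mul_gen_mul_gen_dvd_of_adj hΓ h hQ (hb.trans hD.dvd_right)
      obtain ⟨z', hz'⟩ := ih (length z) (by omega) (x := x * gen Γ b) (z := z) (a := a)
        (by rw [hz, mul_assoc]) ((dvd_mul_right _ _).trans hP') ((dvd_mul_right _ _).trans hQ') rfl
      have hL := congrArg length (hz.symm.trans hz')
      simp only [length_mul, length_gen] at hL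
      have := ih (length z') (by omega) hz' hP' hQ' rfl
      refine Dvd.dvd.trans ⟨gen Γ b * gen Γ a, ?_⟩ this
      rw [mul_assoc, mul_assoc, ← mul_assoc (gen Γ b), ← gen_braid h]
      simp only [mul_assoc]
    · have := ih (length z) (by omega) (x := x * gen Γ b) (z := z) (a := a)
        (by rw [hz, mul_assoc])
        (mul_gen_mul_gen_dvd_of_not_adj hΓ hab h hP (hb.trans hD.dvd_left))
        (mul_gen_mul_gen_dvd_of_not_adj hΓ hab h hQ (hb.trans hD.dvd_right)) rfl
      refine Dvd.dvd.trans ⟨gen Γ b, ?_⟩ this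
      rw [mul_assoc, mul_assoc, gen_comm h]

theorem dvd (hD : IsMaxCommonDvd P Q D) {E : ArtinMonoid Γ} (hP : E ∣ P) (hQ : E ∣ Q) :
    E ∣ D := by
  suffices ∀ y x : ArtinMonoid Γ, x ∣ D → x * y ∣ P → x * y ∣ Q → x * y ∣ D by
    simpa using this E 1 ⟨D, (one_mul D).symm⟩ (by simpa using hP) (by simpa using hQ)
  intro y
  induction hN : length y generalizing y with
  | zero =>
    intro x hx _ _
    rwa [eq_one_of_length_eq_zero hN, mul_one]
  | succ N ih =>
    intro x ⟨z, hz⟩ hP hQ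
    obtain rfl | ⟨a, y, rfl⟩ := eq_one_or_eq_gen_mul y
    · simp at hN
    rw [length_mul, length_gen] at hN
    rw [← mul_assoc] at hP hQ ⊢
    exact ih y (by omega) _ (hD.mul_gen_dvd hΓ hz ((dvd_mul_right _ _).trans hP)
      ((dvd_mul_right _ _).trans hQ)) hP hQ

theorem gen_mul (hD : IsMaxCommonDvd P Q D) (a : I) :
    IsMaxCommonDvd (gen Γ a * P) (gen Γ a * Q) (gen Γ a * D) := by
  obtain ⟨E, hE⟩ := exists_isMaxCommonDvd (gen Γ a * P) (gen Γ a * Q)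
  obtain ⟨E', rfl⟩ := hE.dvd hΓ (dvd_mul_right _ _) (dvd_mul_right _ _)
  refine ⟨mul_dvd_mul_left _ hD.dvd_left, mul_dvd_mul_left _ hD.dvd_right, fun F hP hQ => ?_⟩
  refine (hE.length_le F hP hQ).trans ?_
  have key : ∀ R, gen Γ a * E' ∣ gen Γ a * R → E' ∣ R := by
    rintro R ⟨r, hr⟩
    exact ⟨r, mul_left_cancel (hr.trans (mul_assoc _ _ _))⟩
  simpa using hD.length_le E' (key _ hE.dvd_left) (key _ hE.dvd_right)

/-- The greatest common divisor of two central elements is quasi-central. -/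
theorem exists_gen_mul_eq (hD : IsMaxCommonDvd P Q D) (hP : ∀ a, gen Γ a * P = P * gen Γ a)
    (hQ : ∀ a, gen Γ a * Q = Q * gen Γ a) (a : I) : ∃ b, gen Γ a * D = D * gen Γ b := by
  obtain ⟨y, hy⟩ := (hD.gen_mul hΓ a).dvd hΓ (E := D)
    (hP a ▸ hD.dvd_left.trans (dvd_mul_right _ _)) (hQ a ▸ hD.dvd_right.trans (dvd_mul_right _ _))
  have hL := congrArg length hy
  rw [length_mul, length_mul, length_gen] at hL
  obtain rfl | ⟨b, y, rfl⟩ := eq_one_or_eq_gen_mul y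
  · simp at hL
  · rw [length_mul, length_gen] at hL
    rw [hy, eq_one_of_length_eq_zero (x := y) (by omega), mul_one]
    exact ⟨b, rfl⟩

end IsMaxCommonDvd

theorem gen_dvd_of_adj {R : ArtinMonoid Γ} {g : I → I} (hg : g.Surjective)
    (hR : ∀ a, gen Γ (g a) * R = R * gen Γ a) {a b : I} (hab : Γ.Adj a b) (ha : gen Γ a ∣ R) :
    gen Γ b ∣ R := by
  obtain ⟨a, rfl⟩ := hg a
  obtain ⟨b, rfl⟩ := hg b
  obtain ⟨u, rfl⟩ := ha
  have hu := mul_left_cancel ((hR a).trans (mul_assoc _ _ _))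
  obtain ⟨w, hw, -⟩ := (residual_of_gen_mul_eq hΓ ((hR b).trans (mul_assoc _ _ _))).exists_of_adj
    hab.symm
  exact ⟨w * gen Γ a, by rw [hu, mul_left_cancel hw, mul_assoc]⟩

theorem gen_dvd_of_ne_one (hconn : Γ.Preconnected) {R : ArtinMonoid Γ} {g : I → I}
    (hg : g.Surjective) (hR : ∀ a, gen Γ (g a) * R = R * gen Γ a) (hR1 : R ≠ 1) (b : I) :
    gen Γ b ∣ R := by
  obtain rfl | ⟨a, y, hy⟩ := eq_one_or_eq_gen_mul R
  · exact absurd rfl hR1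
  obtain ⟨p⟩ := hconn a b
  have ha : gen Γ a ∣ R := ⟨y, hy⟩
  clear hy
  induction p with
  | nil => exact ha
  | cons h _ ih => exact ih (gen_dvd_of_adj hΓ hg hR h ha)

/-- Two central elements of the same length in a connected Artin monoid of finite rank agree. -/
theorem eq_of_central_of_length_eq [Finite I] [IsRightCancelMul (ArtinMonoid Γ)]
    (hconn : Γ.Preconnected) {P Q : ArtinMonoid Γ} (hP : ∀ a, gen Γ a * P = P * gen Γ a)
    (hQ : ∀ a, gen Γ a * Q = Q * gen Γ a) (hPQ : length P = length Q) : P = Q := by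
  obtain ⟨D, hD⟩ := exists_isMaxCommonDvd P Q
  choose g hg using hD.exists_gen_mul_eq hΓ hP hQ
  have hinj : g.Injective := fun a b hab => by
    have h : gen Γ a * 1 = gen Γ b * 1 :=
      congrArg (· * 1) (mul_right_cancel ((hg a).trans (hab ▸ (hg b).symm)))
    have hR := residual_of_gen_mul_eq hΓ h
    by_contra hne
    by_cases hadj : Γ.Adj a b
    · obtain ⟨w, hw, -⟩ := hR.exists_of_adj hadj
      exact absurd (congrArg length hw) (by simp; omega)
    · obtain ⟨w, hw, -⟩ := hR.exists_of_not_adj hne hadj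
      exact absurd (congrArg length hw) (by simp; omega)
  have hsurj := Finite.surjective_of_injective hinj
  have quasi : ∀ {R R'}, (∀ a, gen Γ a * R = R * gen Γ a) → R = D * R' →
      ∀ a, gen Γ (g a) * R' = R' * gen Γ a := by
    rintro _ R' h rfl a
    have := h a
    rw [← mul_assoc, hg, mul_assoc, mul_assoc] at this
    exact mul_left_cancel this
  obtain ⟨P', hP'⟩ := hD.dvd_left
  obtain ⟨Q', hQ'⟩ := hD.dvd_right
  have hlen : length P' = length Q' := by
    rw [hP', hQ', length_mul, length_mul] at hPQ
    omega
  have hP1 : P' = 1 := by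
    by_contra hP1
    have hQ1 : Q' ≠ 1 := by
      rintro rfl
      exact hP1 (eq_one_of_length_eq_zero (hlen.trans length_one))
    obtain rfl | ⟨a, -, -⟩ := eq_one_or_eq_gen_mul P'
    · exact hP1 rfl
    have := hD.length_le (D * gen Γ a)
      (hP' ▸ mul_dvd_mul_left D (gen_dvd_of_ne_one hΓ hconn hsurj (quasi hP hP') hP1 a))
      (hQ' ▸ mul_dvd_mul_left D (gen_dvd_of_ne_one hΓ hconn hsurj (quasi hQ hQ') hQ1 a))
    simp at this
  subst hP1
  rw [hP', hQ', eq_one_of_length_eq_zero (hlen.symm.trans length_one)]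

end LeftCancel

section Central

variable {C : ArtinMonoid Γ}

theorem commute_of_forall_gen (hC : ∀ a, gen Γ a * C = C * gen Γ a) (x : ArtinMonoid Γ) :
    Commute x C := by
  have : (⊤ : Submonoid (ArtinMonoid Γ)) ≤ Submonoid.centralizer {C} := by
    rw [← PresentedMonoid.closure_range_of, Submonoid.closure_le]
    rintro _ ⟨a, rfl⟩
    exact Submonoid.mem_centralizer_iff.2 (by rintro _ rfl; exact (hC a).symm)
  exact ((Submonoid.mem_centralizer_iff.1 (this (Submonoid.mem_top x))) C rfl).symm

theorem exists_mul_eq_pow (hC : ∀ a, gen Γ a * C = C * gen Γ a) (hdvd : ∀ a, gen Γ a ∣ C)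
    (x : ArtinMonoid Γ) : ∃ (k : ℕ) (y : ArtinMonoid Γ), x * y = C ^ k := by
  induction hN : length x generalizing x with
  | zero => exact ⟨0, 1, by rw [eq_one_of_length_eq_zero hN, pow_zero, mul_one]⟩
  | succ N ih =>
    obtain rfl | ⟨a, x, rfl⟩ := eq_one_or_eq_gen_mul x
    · simp at hN
    obtain ⟨k, y, hy⟩ := ih x (by simp at hN; omega)
    obtain ⟨c, hc⟩ := hdvd a
    refine ⟨k + 1, y * c, ?_⟩
    rw [mul_assoc, ← mul_assoc x, hy, ((commute_of_forall_gen hC c).pow_right k).symm.eq,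
      ← mul_assoc, ← hc, pow_succ']

theorem isRightCancelMul [IsLeftCancelMul (ArtinMonoid Γ)]
    (hC : ∀ a, gen Γ a * C = C * gen Γ a) (hdvd : ∀ a, gen Γ a ∣ C) :
    IsRightCancelMul (ArtinMonoid Γ) where
  mul_right_cancel x y z h := by
    obtain ⟨k, x', hx⟩ := exists_mul_eq_pow hC hdvd x
    have hmul := congrArg (· * x') h
    simp only [mul_assoc, hx, ((commute_of_forall_gen hC _).pow_right k).eq] at hmul
    exact mul_left_cancel hmul

/-- An Artin monoid with a central element divisible by all generators embeds in a group. -/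
theorem exists_injective_hom_group {I : Type} {Γ : SimpleGraph I} {C : ArtinMonoid Γ}
    [IsLeftCancelMul (ArtinMonoid Γ)]
    (hC : ∀ a, gen Γ a * C = C * gen Γ a) (hdvd : ∀ a, gen Γ a ∣ C) :
    ∃ (H : Type) (_ : Group H) (f : ArtinMonoid Γ →* H), Function.Injective f := by
  have := isRightCancelMul hC hdvd
  have hcomm : ∀ (x : ArtinMonoid Γ) (s : Submonoid.powers C), x * s = s * x := by
    rintro x ⟨_, k, rfl⟩
    exact ((commute_of_forall_gen hC x).pow_right k).eq
  let _ : OreLocalization.OreSet (Submonoid.powers C) :=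
    { ore_right_cancel := fun r₁ r₂ s h => ⟨s, by rw [mul_right_cancel h]⟩
      oreNum := fun r _ => r
      oreDenom := fun _ s => s
      ore_eq := fun r s => (hcomm r s).symm }
  let φ : ArtinMonoid Γ →* OreLocalization (Submonoid.powers C) (ArtinMonoid Γ) :=
    OreLocalization.numeratorHom
  have hφ : ∀ x, IsUnit (φ x) := fun x => by
    obtain ⟨k, y, hxy⟩ := exists_mul_eq_pow hC hdvd x
    have hyx : y * x = C ^ k := by
      apply mul_left_cancel (a := x)
      rw [← mul_assoc, hxy, ((commute_of_forall_gen hC x).pow_right k).eq]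
    have hu : IsUnit (φ (C ^ k)) :=
      OreLocalization.numerator_isUnit (⟨C ^ k, k, rfl⟩ : Submonoid.powers C)
    rw [← hxy, map_mul] at hu
    have hc : Commute (φ x) (φ y) := by
      rw [commute_iff_eq, ← map_mul, ← map_mul, hxy, hyx]
    exact (hc.isUnit_mul_iff.1 hu).1
  refine ⟨_, inferInstance, IsUnit.liftRight φ hφ, fun x y hxy => ?_⟩
  have h : φ x = φ y := congrArg Units.val hxy
  obtain ⟨u, v, h₁, h₂⟩ := OreLocalization.oreDiv_eq_iff.1 h
  simp only [OneMemClass.coe_one, mul_one, smul_eq_mul] at h₁ h₂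
  change (u : ArtinMonoid Γ) * y = v * x at h₁
  rw [h₂] at h₁
  exact (mul_left_cancel h₁).symm

end Central

end ArtinMonoid

/-- The product `s 0 * s 1 * ⋯ * s (k - 1)`. -/
def coxeterProd {M : Type*} [Monoid M] (s : ℕ → M) : ℕ → M
  | 0 => 1
  | k + 1 => coxeterProd s k * s k

section CoxeterProd

variable {M : Type*} [Monoid M] {s : ℕ → M} {m : ℕ}

theorem coxeterProd_commute (hcomm : ∀ i j, i + 2 ≤ j → j < m → s i * s j = s j * s i)
    {k j : ℕ} (hkj : k + 1 ≤ j) (hj : j < m) :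
    coxeterProd s k * s j = s j * coxeterProd s k := by
  induction k with
  | zero => simp [coxeterProd]
  | succ k ih =>
    rw [coxeterProd, mul_assoc, hcomm k j (by omega) hj, ← mul_assoc, ih (by omega), mul_assoc]

theorem coxeterProd_mul (hcomm : ∀ i j, i + 2 ≤ j → j < m → s i * s j = s j * s i)
    (hbraid : ∀ i, i + 1 < m → s i * s (i + 1) * s i = s (i + 1) * s i * s (i + 1))
    {k i : ℕ} (hik : i + 2 ≤ k) (hk : k ≤ m) :
    coxeterProd s k * s i = s (i + 1) * coxeterProd s k := by
  induction k, hik using Nat.le_induction with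
  | base =>
    have h := coxeterProd_commute hcomm (le_refl (i + 1)) (by omega)
    simp only [coxeterProd, mul_assoc] at *
    have hb := hbraid i (by omega)
    rw [hb, ← mul_assoc, h, mul_assoc]
  | succ k hik ih =>
    rw [coxeterProd, mul_assoc, ← hcomm i k hik (by omega), ← mul_assoc, ih (by omega), mul_assoc]

theorem coxeterProd_sq_mul (hcomm : ∀ i j, i + 2 ≤ j → j < m → s i * s j = s j * s i)
    (hbraid : ∀ i, i + 1 < m → s i * s (i + 1) * s i = s (i + 1) * s i * s (i + 1))
    {k : ℕ} (hk : k < m) :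
    coxeterProd s (k + 1) ^ 2 * s k = s 0 * coxeterProd s (k + 1) ^ 2 := by
  induction k with
  | zero => simp [coxeterProd, sq, mul_assoc]
  | succ k ih =>
    have h := coxeterProd_commute hcomm (le_refl (k + 1)) hk
    have hb := hbraid k hk
    have ih := ih (by omega)
    simp only [coxeterProd, sq] at *
    set d := coxeterProd s k
    set a := s k
    set b := s (k + 1)
    calc d * a * b * (d * a * b) * b
      _ = d * a * (b * d) * a * b * b := by simp only [mul_assoc]
      _ = d * a * d * (b * a * b) * b := by rw [← h]; simp only [mul_assoc]
      _ = d * a * d * (a * b * a) * b := by rw [hb]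
      _ = d * a * d * a * (b * a * b) := by simp only [mul_assoc]
      _ = d * a * (d * a) * a * (b * a) := by rw [← hb]; simp only [mul_assoc]
      _ = s 0 * (d * a * d) * (a * b * a) := by rw [ih]; simp only [mul_assoc]
      _ = s 0 * (d * a) * (d * b) * a * b := by rw [hb]; simp only [mul_assoc]
      _ = s 0 * (d * a * b * (d * a * b)) := by rw [h]; simp only [mul_assoc]

theorem coxeterProd_pow_mul (hcomm : ∀ i j, i + 2 ≤ j → j < m → s i * s j = s j * s i)
    (hbraid : ∀ i, i + 1 < m → s i * s (i + 1) * s i = s (i + 1) * s i * s (i + 1))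
    {i j : ℕ} (h : i + j < m) :
    coxeterProd s m ^ j * s i = s (i + j) * coxeterProd s m ^ j := by
  induction j with
  | zero => simp
  | succ j ih =>
    rw [pow_succ', mul_assoc, ih (by omega), ← mul_assoc,
      coxeterProd_mul hcomm hbraid (by omega) le_rfl, mul_assoc, add_assoc]

theorem coxeterProd_pow_central (hcomm : ∀ i j, i + 2 ≤ j → j < m → s i * s j = s j * s i)
    (hbraid : ∀ i, i + 1 < m → s i * s (i + 1) * s i = s (i + 1) * s i * s (i + 1))
    {i : ℕ} (hi : i < m) :
    s i * coxeterProd s m ^ (m + 1) = coxeterProd s m ^ (m + 1) * s i := by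
  obtain ⟨j, rfl⟩ : ∃ j, m = i + j + 1 := ⟨m - i - 1, by omega⟩
  have h₁ := coxeterProd_pow_mul hcomm hbraid (i := i) (j := j) (by omega)
  have h₂ := coxeterProd_sq_mul hcomm hbraid (k := i + j) (by omega)
  have h₃ := coxeterProd_pow_mul hcomm hbraid (i := 0) (j := i) (by omega)
  rw [zero_add] at h₃
  set d := coxeterProd s (i + j + 1)
  have e : d ^ (i + j + 1 + 1) = d ^ i * d ^ 2 * d ^ j := by
    rw [← pow_add, ← pow_add]
    congr 1
    omega
  rw [e, mul_assoc _ (d ^ j), h₁, mul_assoc (d ^ i) (d ^ 2) (s (i + j) * d ^ j),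
    ← mul_assoc (d ^ 2) (s (i + j)), h₂, mul_assoc (s 0), ← mul_assoc (d ^ i) (s 0), h₃]
  simp only [mul_assoc]

theorem dvd_coxeterProd_pow (hcomm : ∀ i j, i + 2 ≤ j → j < m → s i * s j = s j * s i)
    (hbraid : ∀ i, i + 1 < m → s i * s (i + 1) * s i = s (i + 1) * s i * s (i + 1))
    {i : ℕ} (hi : i < m) : s i ∣ coxeterProd s m ^ (m + 1) := by
  have h0 : ∀ k, s 0 ∣ coxeterProd s (k + 1) := fun k => by
    induction k with
    | zero => simp [coxeterProd]
    | succ k ih => exact ih.trans (dvd_mul_right _ _)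
  obtain ⟨t, ht⟩ := h0 (m - 1)
  rw [Nat.sub_add_cancel (by omega)] at ht
  refine Dvd.dvd.trans ⟨coxeterProd s m ^ i * t, ?_⟩ (pow_dvd_pow _ (by omega : i + 1 ≤ m + 1))
  have h := coxeterProd_pow_mul hcomm hbraid (i := 0) (j := i) (by omega)
  rw [zero_add] at h
  rw [← mul_assoc, ← h, mul_assoc, ← ht, pow_succ]

end CoxeterProd

namespace ArtinMonoid

open SimpleGraph in
/-- The Artin monoid of a path has a central element divisible by all the generators. -/
theorem exists_central_pathGraph (m : ℕ) : ∃ C : ArtinMonoid (pathGraph m),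
    (∀ a, gen _ a * C = C * gen _ a) ∧ ∀ a, gen _ a ∣ C := by
  let s : ℕ → ArtinMonoid (pathGraph m) := fun i => if h : i < m then gen _ ⟨i, h⟩ else 1
  have hs : ∀ i (h : i < m), s i = gen _ ⟨i, h⟩ := fun i h => dif_pos h
  have hcomm : ∀ i j, i + 2 ≤ j → j < m → s i * s j = s j * s i := fun i j hij hj => by
    rw [hs i (by omega), hs j hj]
    exact gen_comm (by rw [pathGraph_adj]; simp only; omega)
  have hbraid : ∀ i, i + 1 < m → s i * s (i + 1) * s i = s (i + 1) * s i * s (i + 1) :=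
    fun i hi => by
      rw [hs i (by omega), hs (i + 1) hi]
      exact gen_braid (by rw [pathGraph_adj]; simp)
  refine ⟨coxeterProd s m ^ (m + 1), fun a => ?_, fun a => ?_⟩ <;>
    rw [show gen (pathGraph m) a = s a from (hs a a.2).symm]
  · exact coxeterProd_pow_central hcomm hbraid a.2
  · exact dvd_coxeterProd_pow hcomm hbraid a.2

end ArtinMonoid

open SimpleGraph in
theorem sigma_mul_comm {n : ℕ} {i j : Fin (n - 1)} (hij : i ≠ j)
    (h : ¬ (pathGraph (n - 1)).Adj i j) :
    (σ i * σ j : B n) = σ j * σ i := by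
  have hmem : FreeGroup.of i * FreeGroup.of j * (FreeGroup.of j * FreeGroup.of i)⁻¹ ∈
      braidRels n := by
    refine Or.inl ⟨i, j, ?_, rfl⟩
    rw [pathGraph_adj] at h
    have := Fin.val_ne_of_ne hij
    rw [le_abs]
    omega
  exact mul_inv_eq_one.1 (PresentedGroup.one_of_mem hmem)

open SimpleGraph in
theorem sigma_braid {n : ℕ} {i j : Fin (n - 1)} (h : (pathGraph (n - 1)).Adj i j) :
    (σ i * σ j * σ i : B n) = σ j * σ i * σ j := by
  have hmem : FreeGroup.of i * FreeGroup.of j * FreeGroup.of i *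
      (FreeGroup.of j * FreeGroup.of i * FreeGroup.of j)⁻¹ ∈ braidRels n := by
    refine Or.inr ⟨i, j, ?_, rfl⟩
    rw [pathGraph_adj] at h
    rw [abs_eq zero_le_one]
    omega
  exact mul_inv_eq_one.1 (PresentedGroup.one_of_mem hmem)

namespace ArtinMonoid

open SimpleGraph

/-- The canonical map from the positive braid monoid to the braid group. -/
def toBraid (n : ℕ) : ArtinMonoid (pathGraph (n - 1)) →* B n :=
  PresentedMonoid.lift σ (by
    rintro _ _ (⟨hab, h⟩ | h)
    · simpa using sigma_mul_comm hab h
    · simpa using sigma_braid h)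

theorem pathGraph_not_adj_of_adj_adj (m : ℕ) (a b c : Fin m) (hab : (pathGraph m).Adj a b)
    (hbc : (pathGraph m).Adj b c) : ¬ (pathGraph m).Adj a c := by
  rw [pathGraph_adj] at *
  omega

/-- The positive braid monoid embeds in the braid group. -/
theorem toBraid_injective (n : ℕ) : Function.Injective (toBraid n) := by
  have := isLeftCancelMul (pathGraph_not_adj_of_adj_adj (n - 1))
  obtain ⟨C, hC, hdvd⟩ := exists_central_pathGraph (n - 1)
  obtain ⟨H, _, f, hf⟩ := exists_injective_hom_group hC hdvd
  have hrel : ∀ r ∈ braidRels n, FreeGroup.lift (fun i => f (gen _ i)) r = 1 := by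
    rintro _ (⟨i, j, hij, rfl⟩ | ⟨i, j, hij, rfl⟩)
    · have h : ¬ (pathGraph (n - 1)).Adj i j := by
        rw [pathGraph_adj]
        rw [le_abs] at hij
        omega
      simp only [map_mul, map_inv, FreeGroup.lift_apply_of, mul_inv_eq_one]
      rw [← map_mul, gen_comm h, map_mul]
    · have h : (pathGraph (n - 1)).Adj i j := by
        rw [pathGraph_adj]
        rw [abs_eq zero_le_one] at hij
        omega
      simp only [map_mul, map_inv, FreeGroup.lift_apply_of, mul_inv_eq_one]
      rw [← map_mul, ← map_mul, gen_braid h, map_mul, map_mul]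
  have hcomp : (PresentedGroup.toGroup hrel).comp (toBraid n) = f := by
    ext i
    exact PresentedGroup.toGroup.of hrel
  rw [← hcomp] at hf
  exact Function.Injective.of_comp hf

end ArtinMonoid

/-- The exponent sum of a braid. -/
def exponentSum (n : ℕ) : B n →* Multiplicative ℤ :=
  PresentedGroup.toGroup (f := fun _ => Multiplicative.ofAdd 1) (by
    rintro _ (⟨i, j, -, rfl⟩ | ⟨i, j, -, rfl⟩) <;> simp)

open ArtinMonoid SimpleGraph

theorem exponentSum_toBraid {n : ℕ} (x : ArtinMonoid (pathGraph (n - 1))) :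
    exponentSum n (toBraid n x) = Multiplicative.ofAdd (length x : ℤ) := by
  have : (exponentSum n).comp (toBraid n) =
      (AddMonoidHom.toMultiplicative (Nat.castAddMonoidHom ℤ)).comp (lengthHom _) := by
    ext i
    rfl
  exact DFunLike.congr_fun this x

/-- Every braid is a quotient of a positive braid by a power of a central positive braid. -/
theorem exists_toBraid_pow_mul {n : ℕ} {C : ArtinMonoid (pathGraph (n - 1))}
    (hC : ∀ a, gen _ a * C = C * gen _ a) (hdvd : ∀ a, gen _ a ∣ C) (g : B n) :
    ∃ (k : ℕ) (p : ArtinMonoid (pathGraph (n - 1))), toBraid n (C ^ k) * g = toBraid n p := by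
  have hcomm : ∀ x k, toBraid n x * toBraid n (C ^ k) = toBraid n (C ^ k) * toBraid n x :=
    fun x k => by rw [← map_mul, ((commute_of_forall_gen hC x).pow_right k).eq, map_mul]
  have hg : g ∈ Subgroup.closure (Set.range (PresentedGroup.of (rels := braidRels n))) :=
    PresentedGroup.closure_range_of (braidRels n) ▸ Subgroup.mem_top g
  induction hg using Subgroup.closure_induction_left with
  | one => exact ⟨0, 1, by simp⟩
  | mul_left x hx y _ ih =>
    obtain ⟨i, rfl⟩ := hx
    obtain ⟨k, p, hp⟩ := ih
    refine ⟨k, gen _ i * p, ?_⟩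
    rw [map_mul, ← hp, ← mul_assoc, ← mul_assoc, hcomm]
    rfl
  | inv_mul_cancel x hx y _ ih =>
    obtain ⟨i, rfl⟩ := hx
    obtain ⟨k, p, hp⟩ := ih
    obtain ⟨c, hc⟩ := hdvd i
    refine ⟨k + 1, c * p, ?_⟩
    have hc' : toBraid n C * (PresentedGroup.of i : B n)⁻¹ = toBraid n c := by
      rw [mul_inv_eq_iff_eq_mul]
      have h : gen _ i * C = gen _ i * (c * gen _ i) := by rw [← mul_assoc, ← hc, hC i]
      have h' := congrArg (toBraid n) h
      simp only [map_mul] at h'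
      exact mul_left_cancel h'
    rw [pow_succ, map_mul (toBraid n), mul_assoc, ← mul_assoc (toBraid n C), hc', ← mul_assoc,
      ← hcomm, mul_assoc, hp, map_mul]

/-- For every `n ≥ 2`, the commutator subgroup of the braid group `B n` intersects
the center trivially. -/
theorem commutator_inf_center_braid_eq_bot (n : ℕ) (hn : 2 ≤ n) :
    commutator (B n) ⊓ Subgroup.center (B n) = ⊥ := by
  rw [eq_bot_iff]
  rintro z ⟨hz, hzc⟩
  have hz0 : exponentSum n z = 1 := Abelianization.commutator_subset_ker (exponentSum n) hz
  obtain ⟨C, hC, hdvd⟩ := exists_central_pathGraph (n - 1)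
  obtain ⟨k, p, hp⟩ := exists_toBraid_pow_mul hC hdvd z
  have hΓ := pathGraph_not_adj_of_adj_adj (n - 1)
  have := isLeftCancelMul hΓ
  have := isRightCancelMul hC hdvd
  have hCk : ∀ a, gen _ a * C ^ k = C ^ k * gen _ a := fun a =>
    ((commute_of_forall_gen hC (gen _ a)).pow_right k).eq
  have hpc : ∀ a, gen _ a * p = p * gen _ a := fun a => by
    apply toBraid_injective n
    rw [map_mul, map_mul, ← hp, mul_assoc, ← Subgroup.mem_center_iff.1 hzc, ← mul_assoc,
      ← mul_assoc, ← map_mul, ← map_mul, hCk]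
  have hlen : length p = length (C ^ k) := by
    have := congrArg (exponentSum n) hp
    rw [map_mul, hz0, mul_one, exponentSum_toBraid, exponentSum_toBraid] at this
    exact_mod_cast (Multiplicative.ofAdd.injective this).symm
  rw [eq_of_central_of_length_eq hΓ (pathGraph_preconnected _) hpc hCk hlen] at hp
  exact mul_eq_left.1 hp
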